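/- arXiv:2106.07871 — 2 statements merged into one kernel-verified Lean document; each statement's English description precedes it below -/
import Mathlib

section
/- Let G = (V, E) be a connected loopless multigraph and u a vertex of G. For 1 ≤ i ≤ |V| − 2 let 𝒞_i(u) be the set of connected induced subgraphs G[S] with u ∈ S ⊊ V, |S| = i, such that G − S has no isolated vertices. Then τ(G) = ∏_{v ∈ V \ {u}} d_G(v) − ∑_{i=1}^{|V|−2} ∑_{H ∈ 𝒞_i(u)} ( τ(H) · ∏_{v ∈ V \ V(H)} d_{G − V(H)}(v) ). -/
/-- A loopless undirected multigraph with vertex type `V` and edge type `E`: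
every edge `e` is assigned an unordered pair `G.inc e` of two *distinct*
endpoints (parallel edges are allowed since `E` is an abstract edge type). -/
structure Multigraph (V : Type) (E : Type) where
  inc : E → Sym2 V
  loopless : ∀ e : E, ¬ (inc e).IsDiag

namespace Multigraph

variable {V E : Type}

/-- The degree of a vertex `v` in `G`: the number of edges incident with `v`. -/
noncomputable def deg (G : Multigraph V E) (v : V) : ℕ :=
  {e : E | v ∈ G.inc e}.ncard

/-- Adjacency using only edges from the edge set `F`. -/
def AdjOn (G : Multigraph V E) (F : Set E) (a b : V) : Prop :=
  ∃ e ∈ F, G.inc e = s(a, b)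

/-- Reachability using only edges from the edge set `F`. -/
def Reach (G : Multigraph V E) (F : Set E) : V → V → Prop :=
  Relation.ReflTransGen (G.AdjOn F)

/-- `(S, F)` is a (sub)tree of `G`: `S` is nonempty, every edge of `F` has
both endpoints in `S`, the subgraph `(S, F)` is connected, and
`|F| + 1 = |S|` (for a connected subgraph this says exactly that it is
acyclic, i.e. a tree). -/
def IsTree (G : Multigraph V E) (S : Set V) (F : Set E) : Prop :=
  S.Nonempty ∧ (∀ e ∈ F, ∀ v, v ∈ G.inc e → v ∈ S) ∧
    (∀ a ∈ S, ∀ b ∈ S, G.Reach F a b) ∧ F.ncard + 1 = S.ncard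

/-- `τ(G)`: the number of spanning trees of `G` (a spanning tree is identified
with its edge set; `τ(G) = 0` when `G` is disconnected). -/
noncomputable def tau (G : Multigraph V E) : ℕ :=
  {F : Set E | G.IsTree Set.univ F}.ncard

/-- The degree of `v` in the induced subgraph `G − S`: the number of edges
incident with `v` none of whose endpoints lies in `S`. -/
noncomputable def degAvoid (G : Multigraph V E) (S : Set V) (v : V) : ℕ :=
  {e : E | v ∈ G.inc e ∧ ∀ w, w ∈ G.inc e → w ∉ S}.ncard

/-- The edges of the subgraph of `G` induced by the vertex set `S`. -/
def inducedEdges (G : Multigraph V E) (S : Set V) : Set E :=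
  {e | ∀ w, w ∈ G.inc e → w ∈ S}

/-- The induced subgraph `G[S]` is connected. -/
def ConnectedOn (G : Multigraph V E) (S : Set V) : Prop :=
  S.Nonempty ∧ ∀ a ∈ S, ∀ b ∈ S, G.Reach (G.inducedEdges S) a b

/-- `G` is connected. -/
def Connected (G : Multigraph V E) : Prop :=
  G.ConnectedOn Set.univ

/-- `τ(G[S])`: the number of spanning trees of the induced subgraph `G[S]`
(equal to `1` when `S` is a single vertex). -/
noncomputable def tauOn (G : Multigraph V E) (S : Set V) : ℕ :=
  {F : Set E | G.IsTree S F}.ncard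

/-- `𝒞_i(u)`: the (vertex sets of the) connected induced subgraphs `G[S]`
with `u ∈ S ⊊ V`, `|S| = i`, such that `G − S` has no isolated vertices. -/
def C (G : Multigraph V E) (u : V) (i : ℕ) : Set (Set V) :=
  {S | u ∈ S ∧ S ≠ Set.univ ∧ S.ncard = i ∧ G.ConnectedOn S ∧
    ∀ v, v ∉ S → 0 < G.degAvoid S v}

open Relation

/-- Partial functions `f : V → Option E` with domain `D` and `f v ∈ t v` for `v ∈ D`. -/
def selections (D : Set V) (t : V → Set E) : Set (V → Option E) :=
  {f | ∀ v, (v ∈ D → ∃ e ∈ t v, f v = some e) ∧ (v ∉ D → f v = none)}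

theorem ncard_selections [Fintype V] [Fintype E] (D : Set V) (t : V → Set E) :
    (selections D t).ncard = ∏ᶠ v ∈ D, (t v).ncard := by
  classical
  let s : V → Finset (Option E) := fun v =>
    if v ∈ D then (t v).toFinset.map Function.Embedding.some else {none}
  have h : selections D t = ↑(Fintype.piFinset s) := by
    ext f
    simp only [selections, Set.mem_ofPred_eq, Finset.mem_coe, Fintype.mem_piFinset, s]
    refine forall_congr' fun v => ?_
    by_cases hv : v ∈ D <;> simp [hv, eq_comm]
  rw [h, Set.ncard_coe_finset, Fintype.card_piFinset, finprod_mem_eq_toFinset_prod,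
    ← Set.filter_mem_univ_eq_toFinset, Finset.prod_filter]
  · refine Finset.prod_congr rfl fun v _ => ?_
    by_cases hv : v ∈ D <;> simp [s, hv, Set.ncard_eq_toFinset_card']

/-- `f` sends `a` to an edge joining `a` and `b`. -/
def Step (G : Multigraph V E) (f : V → Option E) (a b : V) : Prop :=
  ∃ e, f a = some e ∧ G.inc e = s(a, b)

theorem mem_of_reflTransGen {r : V → V → Prop} {P : Set V}
    (hP : ∀ a ∈ P, ∀ b, r a b → b ∈ P) {a b : V} (h : ReflTransGen r a b) (ha : a ∈ P) : b ∈ P := by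
  induction h with
  | refl => exact ha
  | tail _ hbc ih => exact hP _ ih _ hbc

/-- Edges at `v` with both endpoints in `S`. -/
def edgesWithin (G : Multigraph V E) (S : Set V) (v : V) : Set E :=
  {e | v ∈ G.inc e ∧ ∀ w, w ∈ G.inc e → w ∈ S}

/-- Parent-edge functions of trees on `S` rooted at `u`. -/
def rootedMaps (G : Multigraph V E) (u : V) (S : Set V) : Set (V → Option E) :=
  {f | f ∈ selections (S \ {u}) (G.edgesWithin S) ∧ ∀ v ∈ S, ReflTransGen (G.Step f) v u}

/-- The edges selected by `f`. -/
def edgesOf (f : V → Option E) : Set E := {e | ∃ v, f v = some e}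

variable {G : Multigraph V E} {u : V} {S : Set V} {f g : V → Option E}

theorem Reach.symm {F : Set E} {a b : V} (h : G.Reach F a b) : G.Reach F b a := by
  have : Std.Symm (G.AdjOn F) := ⟨fun x y ⟨e, he, hxy⟩ => ⟨e, he, by rw [hxy, Sym2.eq_swap]⟩⟩
  exact ReflTransGen.stdSymm.symm _ _ h

theorem eq_none_root (hf : f ∈ G.rootedMaps u S) : f u = none :=
  (hf.1 u).2 (by simp)

theorem mem_of_eq_some (hf : f ∈ G.rootedMaps u S) {v : V} {e : E} (h : f v = some e) :
    v ∈ S ∧ v ≠ u ∧ e ∈ G.edgesWithin S v := by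
  by_cases hv : v ∈ S \ {u}
  · obtain ⟨e', he', h'⟩ := (hf.1 v).1 hv
    obtain rfl : e' = e := by simpa [h] using h'.symm
    exact ⟨hv.1, hv.2, he'⟩
  · simp [(hf.1 v).2 hv] at h

theorem eq_of_eq_some (hf : f ∈ G.rootedMaps u S) {v w : V} {e : E}
    (hv : f v = some e) (hw : f w = some e) : v = w := by
  by_contra hne
  have hv' := mem_of_eq_some hf hv
  have hw' := mem_of_eq_some hf hw
  have he : G.inc e = s(v, w) := (Sym2.mem_and_mem_iff hne).1 ⟨hv'.2.2.1, hw'.2.2.1⟩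
  have hmem : u ∈ ({v, w} : Set V) := by
    refine mem_of_reflTransGen (r := G.Step f) ?_ (hf.2 v hv'.1) (by simp)
    rintro a ha b ⟨e', he', hab⟩
    have : e' = e := by
      rcases ha with rfl | rfl
      · simpa [hv] using he'.symm
      · simpa [hw] using he'.symm
    subst this
    have hb : b ∈ G.inc e' := by rw [hab]; simp
    simpa [he] using hb
  rcases hmem with rfl | rfl
  · exact hv'.2.1 rfl
  · exact hw'.2.1 rfl

theorem ncard_edgesOf [Fintype V] (hu : u ∈ S) (hf : f ∈ G.rootedMaps u S) :
    (edgesOf f).ncard + 1 = S.ncard := by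
  rw [← Set.ncard_sdiff_singleton_add_one hu (Set.toFinite S)]
  congr 1
  have hex : ∀ v ∈ S \ {u}, ∃ e, f v = some e := fun v hv =>
    let ⟨e, _, h⟩ := (hf.1 v).1 hv
    ⟨e, h⟩
  symm
  refine Set.ncard_congr (fun v hv => (hex v hv).choose) ?_ ?_ ?_
  · exact fun v hv => ⟨v, (hex v hv).choose_spec⟩
  · intro v w hv hw h
    refine eq_of_eq_some hf (hex v hv).choose_spec ?_
    rw [h]
    exact (hex w hw).choose_spec
  · rintro e ⟨v, hv⟩
    have hv' := mem_of_eq_some hf hv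
    refine ⟨v, ⟨hv'.1, hv'.2.1⟩, ?_⟩
    have := (hex v ⟨hv'.1, hv'.2.1⟩).choose_spec
    exact Option.some.inj (this.symm.trans hv)

theorem isTree_edgesOf [Fintype V] (hu : u ∈ S) (hf : f ∈ G.rootedMaps u S) :
    G.IsTree S (edgesOf f) := by
  refine ⟨⟨u, hu⟩, ?_, ?_, ncard_edgesOf hu hf⟩
  · rintro e ⟨v, hv⟩
    exact (mem_of_eq_some hf hv).2.2.2
  · have key : ∀ a ∈ S, G.Reach (edgesOf f) a u := fun a ha =>
      ReflTransGen.mono (fun x y ⟨e, he, hxy⟩ => ⟨e, ⟨x, he⟩, hxy⟩) _ _ (hf.2 a ha)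
    exact fun a ha b hb => (key a ha).trans (key b hb).symm

theorem injOn_edgesOf : Set.InjOn edgesOf (G.rootedMaps u S) := by
  intro f hf g hg hfg
  ext1 v
  by_contra hne
  have huD : u ∈ {v | f v ≠ g v} := by
    have hv : v ∈ S := by
      by_contra hv
      exact hne (by rw [(hf.1 v).2 (fun h => hv h.1), (hg.1 v).2 (fun h => hv h.1)])
    refine mem_of_reflTransGen (r := G.Step f) ?_ (hf.2 v hv) hne
    rintro a ha b ⟨e, he, hab⟩ hb
    obtain ⟨w, hw⟩ : e ∈ edgesOf g := hfg ▸ ⟨a, he⟩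
    have haw : w ≠ a := by
      rintro rfl
      exact ha (he.trans hw.symm)
    have hwb : w = b := by
      have := (mem_of_eq_some hg hw).2.2.1
      rw [hab, Sym2.mem_iff] at this
      exact this.resolve_left haw
    subst hwb
    exact haw (eq_of_eq_some hf (hb.trans hw) he)
  exact huD (by rw [eq_none_root hf, eq_none_root hg])

/-- The simple graph of adjacency through edges of `F`. -/
def simpleGraphOn (G : Multigraph V E) (F : Set E) : SimpleGraph V where
  Adj := G.AdjOn F
  symm := ⟨fun x y ⟨e, he, hxy⟩ => ⟨e, he, by rw [hxy, Sym2.eq_swap]⟩⟩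
  loopless := ⟨fun x ⟨e, _, hxx⟩ => G.loopless e (by simp [hxx])⟩

theorem exists_adjOn_dist_lt {F : Set E} {v : V} (h : G.Reach F v u) (hv : v ≠ u) :
    ∃ w, G.AdjOn F v w ∧ (G.simpleGraphOn F).dist w u < (G.simpleGraphOn F).dist v u := by
  have hr : (G.simpleGraphOn F).Reachable v u :=
    (SimpleGraph.reachable_iff_reflTransGen v u).2 h
  obtain ⟨p, hp⟩ := hr.exists_walk_length_eq_dist
  cases p with
  | nil => exact absurd rfl hv
  | cons hadj q =>
    refine ⟨_, hadj, ?_⟩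
    have := SimpleGraph.dist_le q
    rw [SimpleGraph.Walk.length_cons] at hp
    omega

theorem exists_edgesOf_eq [Fintype V] [Fintype E] (hu : u ∈ S) {F : Set E} (hF : G.IsTree S F) :
    ∃ f ∈ G.rootedMaps u S, edgesOf f = F := by
  classical
  obtain ⟨-, hinc, hreach, hcard⟩ := hF
  have hex : ∀ v ∈ S \ {u}, ∃ e ∈ F, ∃ w, G.inc e = s(v, w) ∧
      (G.simpleGraphOn F).dist w u < (G.simpleGraphOn F).dist v u := by
    intro v hv
    obtain ⟨w, ⟨e, he, hvw⟩, hlt⟩ := exists_adjOn_dist_lt (hreach v hv.1 u hu) hv.2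
    exact ⟨e, he, w, hvw, hlt⟩
  choose p hpF q hpq hlt using hex
  let f : V → Option E := fun v => if hv : v ∈ S \ {u} then some (p v hv) else none
  have hfv : ∀ v hv, f v = some (p v hv) := fun v hv => dif_pos hv
  have hsel : f ∈ selections (S \ {u}) (G.edgesWithin S) := by
    refine fun v => ⟨fun hv => ⟨p v hv, ⟨?_, hinc _ (hpF v hv)⟩, hfv v hv⟩, fun hv => dif_neg hv⟩
    simp [hpq v hv]
  have hroot : ∀ n, ∀ v ∈ S, (G.simpleGraphOn F).dist v u = n → ReflTransGen (G.Step f) v u := by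
    intro n
    induction n using Nat.strong_induction_on with
    | _ n ih =>
      intro v hv hn
      by_cases hvu : v = u
      · rw [hvu]
      · have hv' : v ∈ S \ {u} := ⟨hv, hvu⟩
        have hq : q v hv' ∈ S := hinc _ (hpF v hv') _ (by simp [hpq v hv'])
        exact .head ⟨p v hv', hfv v hv', hpq v hv'⟩ (ih _ (hn ▸ hlt v hv') _ hq rfl)
  have hf : f ∈ G.rootedMaps u S := ⟨hsel, fun v hv => hroot _ v hv rfl⟩
  refine ⟨f, hf, Set.eq_of_subset_of_ncard_le ?_ ?_ (Set.toFinite F)⟩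
  · rintro e ⟨v, hv⟩
    have hv' := mem_of_eq_some hf hv
    rw [hfv v ⟨hv'.1, hv'.2.1⟩, Option.some_inj] at hv
    exact hv ▸ hpF v ⟨hv'.1, hv'.2.1⟩
  · have := ncard_edgesOf hu hf
    omega

theorem ncard_rootedMaps [Fintype V] [Fintype E] (hu : u ∈ S) :
    (G.rootedMaps u S).ncard = G.tauOn S :=
  Set.ncard_congr (fun f _ => edgesOf f) (fun _ hf => isTree_edgesOf hu hf)
    (fun _ _ hf hg h => injOn_edgesOf hf hg h)
    (fun _ hF => let ⟨f, hf, h⟩ := exists_edgesOf_eq hu hF; ⟨f, hf, h⟩)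

/-- The vertices from which following `f` leads to `u`. -/
def basin (G : Multigraph V E) (u : V) (f : V → Option E) : Set V :=
  {v | ReflTransGen (G.Step f) v u}

/-- All choices of an incident edge at every vertex other than `u`. -/
def edgeChoices (G : Multigraph V E) (u : V) : Set (V → Option E) :=
  selections {u}ᶜ fun v => {e | v ∈ G.inc e}

theorem mem_basin_of_step (hf : f u = none) {a b : V} (h : G.Step f a b) :
    a ∈ G.basin u f ↔ b ∈ G.basin u f := by
  refine ⟨fun ha => ?_, fun hb => .head h hb⟩
  obtain ⟨e, he, hab⟩ := h
  rcases ReflTransGen.cases_head ha with rfl | ⟨c, ⟨e', he', hac⟩, hc⟩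
  · simp [hf] at he
  · obtain rfl : e = e' := by simpa [he] using he'
    rw [hab, Sym2.congr_right] at hac
    exact hac ▸ hc

open Classical in
/-- The function equal to `g` on `S` and to `h` off `S`. -/
theorem piecewise_mem_edgeChoices {h : V → Option E} (hu : u ∈ S) (hg : g ∈ G.rootedMaps u S)
    (hh : h ∈ selections Sᶜ (G.edgesWithin Sᶜ)) :
    S.piecewise g h ∈ G.edgeChoices u ∧ G.basin u (S.piecewise g h) = S := by
  refine ⟨fun v => ⟨fun hv => ?_, fun hv => ?_⟩, ?_⟩
  · by_cases hvS : v ∈ S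
    · obtain ⟨e, he, hge⟩ := (hg.1 v).1 ⟨hvS, hv⟩
      exact ⟨e, he.1, by simp [hvS, hge]⟩
    · obtain ⟨e, he, hhe⟩ := (hh v).1 hvS
      exact ⟨e, he.1, by simp [hvS, hhe]⟩
  · obtain rfl : v = u := by simpa using hv
    simp [hu, eq_none_root hg]
  · ext v
    refine ⟨fun hv => ?_, fun hv => ?_⟩
    · by_contra hvS
      refine absurd hu (mem_of_reflTransGen (P := Sᶜ) ?_ hv hvS)
      rintro a ha b ⟨e, he, hab⟩
      obtain ⟨e', he', hhe⟩ := (hh a).1 ha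
      rw [Set.piecewise_eq_of_notMem _ _ _ ha, hhe, Option.some_inj] at he
      subst he
      exact he'.2 b (by simp [hab])
    · refine ReflTransGen.mono ?_ _ _ (hg.2 v hv)
      rintro a b ⟨e, he, hab⟩
      exact ⟨e, by rw [Set.piecewise_eq_of_mem _ _ _ (mem_of_eq_some hg he).1, he], hab⟩

open Classical in
theorem split_mem (hf : f ∈ G.edgeChoices u) (hS : G.basin u f = S) :
    S.piecewise f (fun _ => none) ∈ G.rootedMaps u S ∧
      S.piecewise (fun _ => none) f ∈ selections Sᶜ (G.edgesWithin Sᶜ) := by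
  subst hS
  have hfu : f u = none := (hf u).2 (by simp)
  have hu : u ∈ G.basin u f := .refl
  have hedge : ∀ v, v ≠ u → ∃ e w, f v = some e ∧ G.inc e = s(v, w) := by
    intro v hv
    obtain ⟨e, he, hfe⟩ := (hf v).1 hv
    obtain ⟨w, hw⟩ := he
    exact ⟨e, w, hfe, hw⟩
  refine ⟨⟨fun v => ⟨fun hv => ?_, fun hv => ?_⟩, fun v hv => ?_⟩,
    fun v => ⟨fun hv => ?_, fun hv => ?_⟩⟩
  · obtain ⟨e, w, he, hvw⟩ := hedge v hv.2
    have hw := (mem_basin_of_step hfu ⟨e, he, hvw⟩).1 hv.1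
    refine ⟨e, ⟨by simp [hvw], ?_⟩, by rw [Set.piecewise_eq_of_mem _ _ _ hv.1, he]⟩
    intro x hx
    rw [hvw, Sym2.mem_iff] at hx
    rcases hx with rfl | rfl
    exacts [hv.1, hw]
  · by_cases hvS : v ∈ G.basin u f
    · obtain rfl : v = u := by
        by_contra h
        exact hv ⟨hvS, h⟩
      rw [Set.piecewise_eq_of_mem _ _ _ hvS, hfu]
    · rw [Set.piecewise_eq_of_notMem _ _ _ hvS]
  · induction (hv : ReflTransGen (G.Step f) v u) using ReflTransGen.head_induction_on with
    | refl => exact .refl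
    | head hab hbu ih =>
      have ha := (mem_basin_of_step hfu hab).2 hbu
      obtain ⟨e, he, hab'⟩ := hab
      exact .head ⟨e, by rw [Set.piecewise_eq_of_mem _ _ _ ha, he], hab'⟩ ih
  · have hvu : v ≠ u := fun h => hv (h ▸ hu)
    obtain ⟨e, w, he, hvw⟩ := hedge v hvu
    have hw := mt (mem_basin_of_step hfu ⟨e, he, hvw⟩).2 hv
    refine ⟨e, ⟨by simp [hvw], ?_⟩, by rw [Set.piecewise_eq_of_notMem _ _ _ hv, he]⟩
    intro x hx
    rw [hvw, Sym2.mem_iff] at hx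
    rcases hx with rfl | rfl
    exacts [hv, hw]
  · rw [Set.piecewise_eq_of_mem _ _ _ (not_not.1 hv)]

theorem ncard_basin_fiber [Fintype V] [Fintype E] (hu : u ∈ S) :
    {f | f ∈ G.edgeChoices u ∧ G.basin u f = S}.ncard =
      G.tauOn S * ∏ᶠ v ∈ Sᶜ, G.degAvoid S v := by
  classical
  rw [← ncard_rootedMaps hu]
  change _ = _ * ∏ᶠ v ∈ Sᶜ, (G.edgesWithin Sᶜ v).ncard
  rw [← ncard_selections, ← Set.ncard_prod]
  refine Set.ncard_congr
    (fun f _ => (S.piecewise f (fun _ => none), S.piecewise (fun _ => none) f)) ?_ ?_ ?_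
  · exact fun f hf => split_mem hf.1 hf.2
  · intro f g _ _ h
    rw [Prod.mk.injEq] at h
    ext1 v
    by_cases hv : v ∈ S
    · simpa [hv] using congrFun h.1 v
    · simpa [hv] using congrFun h.2 v
  · rintro ⟨g, h⟩ ⟨hg, hh⟩
    refine ⟨S.piecewise g h, piecewise_mem_edgeChoices hu hg hh, Prod.ext ?_ ?_⟩
    · ext1 v
      by_cases hv : v ∈ S
      · simp [hv]
      · simpa [hv] using ((hg.1 v).2 fun h => hv h.1).symm
    · ext1 v
      by_cases hv : v ∈ S
      · simpa [hv] using ((hh v).2 fun h => h hv).symm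
      · simp [hv]

open Classical in
theorem prod_deg_eq_sum_basin [Fintype V] [Fintype E] (G : Multigraph V E) (u : V) :
    ∏ᶠ v ∈ ({u}ᶜ : Set V), G.deg v =
      ∑ S : Set V with u ∈ S, G.tauOn S * ∏ᶠ v ∈ Sᶜ, G.degAvoid S v := by
  change ∏ᶠ v ∈ ({u}ᶜ : Set V), {e | v ∈ G.inc e}.ncard = _
  rw [← ncard_selections]
  change (G.edgeChoices u).ncard = _
  rw [Set.ncard_eq_toFinset_card', Finset.card_eq_sum_card_fiberwise (f := G.basin u)
    (t := {S : Set V | u ∈ S})]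
  · refine Finset.sum_congr rfl fun S hS => ?_
    rw [← ncard_basin_fiber (by simpa using hS), ← Set.ncard_coe_finset]
    congr 1
    ext f
    simp
  · intro f _
    rw [Finset.mem_coe, Finset.mem_filter]
    exact ⟨Finset.mem_univ _, ReflTransGen.refl⟩

theorem connectedOn_of_tauOn_ne_zero (h : G.tauOn S ≠ 0) : G.ConnectedOn S := by
  obtain ⟨F, hne, hinc, hreach, -⟩ := Set.nonempty_of_ncard_ne_zero h
  exact ⟨hne, fun a ha b hb => ReflTransGen.mono
    (fun x y ⟨e, he, hxy⟩ => ⟨e, hinc e he, hxy⟩) _ _ (hreach a ha b hb)⟩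

theorem ncard_add_two_le [Fintype V] (hS : S ≠ Set.univ)
    (hdeg : ∀ v, v ∉ S → 0 < G.degAvoid S v) : S.ncard + 2 ≤ Fintype.card V := by
  obtain ⟨v, hv⟩ := (Set.ne_univ_iff_exists_notMem S).1 hS
  obtain ⟨e, ⟨w, hw⟩, hav⟩ := Set.nonempty_of_ncard_ne_zero (hdeg v hv).ne'
  have hvw : v ≠ w := by
    rintro rfl
    exact G.loopless e (by simp [hw])
  have h : 1 < Sᶜ.ncard :=
    (Set.one_lt_ncard (Set.toFinite _)).2 ⟨v, hv, w, hav w (by simp [hw]), hvw⟩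
  have := Set.ncard_add_ncard_compl S
  rw [Nat.card_eq_fintype_card] at this
  omega

open Classical in
theorem sum_C_eq_sum [Fintype V] (G : Multigraph V E) (u : V) (φ : Set V → ℤ)
    (hφ : ∀ S, φ S ≠ 0 → G.ConnectedOn S ∧ ∀ v, v ∉ S → 0 < G.degAvoid S v) :
    ∑ i ∈ Finset.Icc 1 (Fintype.card V - 2), ∑ᶠ S ∈ G.C u i, φ S =
      ∑ S : Set V with u ∈ S ∧ S ≠ Set.univ, φ S := by
  let T : Finset (Set V) := {S | (u ∈ S ∧ S ≠ Set.univ) ∧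
    G.ConnectedOn S ∧ ∀ v, v ∉ S → 0 < G.degAvoid S v}
  have hT : ∑ S ∈ T, φ S = ∑ S : Set V with u ∈ S ∧ S ≠ Set.univ, φ S := by
    simp only [T]
    rw [← Finset.filter_filter]
    exact Finset.sum_filter_of_ne fun S _ h => hφ S h
  rw [← hT, ← Finset.sum_fiberwise_of_maps_to (g := Set.ncard)
    (t := Finset.Icc 1 (Fintype.card V - 2))]
  · refine Finset.sum_congr rfl fun i _ => ?_
    have hC : G.C u i = ↑(T.filter fun S => S.ncard = i) := by
      ext S
      simp only [C, T, Finset.mem_filter, Finset.mem_univ, true_and, Set.mem_ofPred_eq,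
        Finset.mem_coe]
      tauto
    rw [hC, finsum_mem_coe_finset]
  · intro S hS
    simp only [T, Finset.mem_filter, Finset.mem_univ, true_and] at hS
    have h1 : 0 < S.ncard := (Set.ncard_pos (Set.toFinite S)).2 ⟨u, hS.1.1⟩
    have h2 := ncard_add_two_le hS.1.2 hS.2.2
    rw [Finset.mem_Icc]
    omega

/-- For a connected loopless multigraph `G` and a vertex `u`,
`τ(G) = ∏_{v ∈ V∖{u}} d_G(v) −
  ∑_{i=1}^{|V|−2} ∑_{H ∈ 𝒞_i(u)} τ(H) · ∏_{v ∈ V∖V(H)} d_{G−V(H)}(v)`. -/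
theorem tau_eq_prod_deg_sub_connected {V E : Type} [Fintype V] [Fintype E]
    (G : Multigraph V E) (hG : G.Connected) (u : V) :
    (G.tau : ℤ) =
      (∏ᶠ v ∈ ({u}ᶜ : Set V), (G.deg v : ℤ)) -
        ∑ i ∈ Finset.Icc 1 (Fintype.card V - 2),
          ∑ᶠ S ∈ G.C u i, (G.tauOn S : ℤ) * ∏ᶠ v ∈ Sᶜ, (G.degAvoid S v : ℤ) := by
  classical
  have hcast : ∀ (D : Set V) (d : V → ℕ),
      ∏ᶠ v ∈ D, (d v : ℤ) = ((∏ᶠ v ∈ D, d v : ℕ) : ℤ) := fun D d =>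
    ((Nat.castRingHom ℤ).toMonoidHom.map_finprod_mem d (Set.toFinite D)).symm
  rw [sum_C_eq_sum, hcast, prod_deg_eq_sum_basin, eq_sub_iff_add_eq]
  · have hsplit : Finset.univ.filter (fun S : Set V => u ∈ S) =
        insert Set.univ (Finset.univ.filter fun S : Set V => u ∈ S ∧ S ≠ Set.univ) := by
      ext S
      by_cases hS : S = Set.univ <;> simp [hS]
    rw [hsplit, Finset.sum_insert (by simp)]
    simp only [Nat.cast_add, Nat.cast_sum, Nat.cast_mul, ← hcast]
    simp [tau, tauOn]
  · intro S hS
    refine ⟨connectedOn_of_tauOn_ne_zero fun h => hS (by simp [h]), fun v hv => ?_⟩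
    rw [pos_iff_ne_zero]
    intro h
    refine hS ?_
    rw [finprod_mem_eq_toFinset_prod, Finset.prod_eq_zero (Set.mem_toFinset.2 hv) (by simp [h]),
      mul_zero]

end Multigraph
end

section
/- Let G = (V, E) be a loopless multigraph with no isolated vertices, V = {v_1, …, v_n}, E = {e_1, …, e_m}, and let F(G, ω) = ∏_{i=1}^{n} ( ∑_{e_j ∈ E_G(v_i)} y_j ). Then the edge covering number ρ(G) equals the minimum value of k + r over all monomials y_{i_1}² ⋯ y_{i_r}² y_{j_1} ⋯ y_{j_k} (with pairwise distinct indices and k + 2r = n) appearing in the expansion of F(G, ω), and the matching number ν(G) equals the maximum value of r over all such monomials. -/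
namespace Multigraph

variable {V E : Type}

/-- A set of edges is a matching if its edges are pairwise non-adjacent
(no two of them share an endpoint). -/
def IsMatching (G : Multigraph V E) (M : Set E) : Prop :=
  ∀ e ∈ M, ∀ f ∈ M, e ≠ f → ∀ v : V, ¬(v ∈ G.inc e ∧ v ∈ G.inc f)

/-- A set of edges is an edge cover if every vertex is incident with at
least one edge of the set. -/
def IsEdgeCover (G : Multigraph V E) (C : Set E) : Prop :=
  ∀ v : V, ∃ e ∈ C, v ∈ G.inc e

/-- `f : V → E` is a choice of one incident edge for every vertex; these
choices index the monomials in the expansion of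
`F(G,ω) = ∏_{v} ∑_{e ∈ E_G(v)} y_e`: the monomial of `f` is
`∏_v y_{f v}`, in which the exponent of an edge `e` is the number of
vertices `v` with `f v = e`, i.e. `{v | f v = e}.ncard`. -/
def IsChoice (G : Multigraph V E) (f : V → E) : Prop :=
  ∀ v : V, v ∈ G.inc (f v)

/-- The edge covering number `ρ(G)`: the minimum size of an edge cover. -/
noncomputable def coverNumber (G : Multigraph V E) : ℕ :=
  sInf {c : ℕ | ∃ C : Set E, G.IsEdgeCover C ∧ C.ncard = c}

/-- The matching number `ν(G)`: the maximum size of a matching. -/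
noncomputable def matchingNumber (G : Multigraph V E) : ℕ :=
  sSup {c : ℕ | ∃ M : Set E, G.IsMatching M ∧ M.ncard = c}

theorem ncard_endpoints (G : Multigraph V E) (e : E) : {v : V | v ∈ G.inc e}.ncard = 2 := by
  have hl := G.loopless e
  generalize G.inc e = s at hl
  induction s using Sym2.ind with
  | _ a b =>
    have hab : a ≠ b := by simpa using hl
    have hset : {v : V | v ∈ s(a, b)} = {a, b} := by
      ext v
      simp
    rw [hset, Set.ncard_pair hab]

namespace IsChoice

variable {G : Multigraph V E} {f : V → E}

theorem fiber_subset (hf : G.IsChoice f) (e : E) :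
    {v : V | f v = e} ⊆ {v : V | v ∈ G.inc e} := by
  rintro v rfl
  exact hf v

theorem ncard_fiber_le_two [Finite V] (hf : G.IsChoice f) (e : E) :
    {v : V | f v = e}.ncard ≤ 2 :=
  (Set.ncard_le_ncard (hf.fiber_subset e)).trans (G.ncard_endpoints e).le

theorem isEdgeCover_range (hf : G.IsChoice f) : G.IsEdgeCover (Set.range f) :=
  fun v => ⟨f v, ⟨v, rfl⟩, hf v⟩

theorem ncard_range [Finite V] [Finite E] (hf : G.IsChoice f) :
    (Set.range f).ncard = {e : E | {v : V | f v = e}.ncard = 1}.ncard +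
      {e : E | {v : V | f v = e}.ncard = 2}.ncard := by
  rw [← Set.ncard_union_eq]
  · congr 1
    ext e
    have hle := hf.ncard_fiber_le_two e
    have hpos : 0 < {v : V | f v = e}.ncard ↔ e ∈ Set.range f :=
      Set.ncard_pos
    rw [← hpos]
    simp only [Set.mem_union, Set.mem_ofPred_eq]
    omega
  · rw [Set.disjoint_left]
    intro e h₁ h₂
    simp only [Set.mem_ofPred_eq] at h₁ h₂
    omega

/-- The edges chosen by both of their endpoints form a matching. -/
theorem isMatching_ncard_fiber_eq_two [Finite V] (hf : G.IsChoice f) :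
    G.IsMatching {e : E | {v : V | f v = e}.ncard = 2} := by
  have key : ∀ e, {v : V | f v = e}.ncard = 2 → ∀ v ∈ G.inc e, f v = e := by
    intro e he v hv
    have heq : {v : V | f v = e} = {v : V | v ∈ G.inc e} :=
      Set.eq_of_subset_of_ncard_le (hf.fiber_subset e) (by rw [he, G.ncard_endpoints])
    exact heq.symm.subset hv
  rintro e he e' he' hne v ⟨hv, hv'⟩
  exact hne ((key e he v hv).symm.trans (key e' he' v hv'))

end IsChoice

theorem IsEdgeCover.exists_isChoice {G : Multigraph V E} {C : Set E} (hC : G.IsEdgeCover C) :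
    ∃ f : V → E, G.IsChoice f ∧ Set.range f ⊆ C := by
  choose f hfC hf using hC
  exact ⟨f, hf, Set.range_subset_iff.2 hfC⟩

/-- Every matching extends to a choice in which its edges are chosen by both endpoints. -/
theorem IsMatching.exists_isChoice {G : Multigraph V E} {M : Set E} (hM : G.IsMatching M)
    (hiso : ∀ v : V, ∃ e : E, v ∈ G.inc e) :
    ∃ f : V → E, G.IsChoice f ∧ M ⊆ {e : E | {v : V | f v = e}.ncard = 2} := by
  have hex : ∀ v : V, ∃ e : E, v ∈ G.inc e ∧ ∀ e' ∈ M, v ∈ G.inc e' → e = e' := by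
    intro v
    by_cases h : ∃ e ∈ M, v ∈ G.inc e
    · obtain ⟨e, he, hv⟩ := h
      refine ⟨e, hv, fun e' he' hv' => ?_⟩
      by_contra hne
      exact hM e he e' he' hne v ⟨hv, hv'⟩
    · obtain ⟨e, hv⟩ := hiso v
      exact ⟨e, hv, fun e' he' hv' => (h ⟨e', he', hv'⟩).elim⟩
  choose f hf hfM using hex
  refine ⟨f, hf, fun e he => ?_⟩
  have heq : {v : V | f v = e} = {v : V | v ∈ G.inc e} :=
    (IsChoice.fiber_subset hf e).antisymm fun v hv => hfM v e he hv
  rw [Set.mem_ofPred_eq, heq, G.ncard_endpoints]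

/-- For a loopless multigraph `G` without isolated vertices: the monomials
of `F(G,ω) = ∏_{v} ∑_{e ∈ E_G(v)} y_e` are the products `∏_v y_{f v}` over
choices `f` of one incident edge per vertex; writing such a monomial as
`y_{i₁}² ⋯ y_{i_r}² · y_{j₁} ⋯ y_{j_k}` (so `r = #{e : e is chosen twice}`
and `k = #{e : e is chosen once}`), the edge covering number `ρ(G)` is the
minimum of `k + r` over all monomials, and the matching number `ν(G)` is
the maximum of `r` over all monomials. -/
theorem coverNumber_and_matchingNumber_via_expansion
    {V E : Type} [Fintype V] [Fintype E]
    (G : Multigraph V E) (hiso : ∀ v : V, ∃ e : E, v ∈ G.inc e) :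
    G.coverNumber =
      sInf {c : ℕ | ∃ f : V → E, G.IsChoice f ∧
        c = {e : E | {v : V | f v = e}.ncard = 1}.ncard +
              {e : E | {v : V | f v = e}.ncard = 2}.ncard} ∧
    G.matchingNumber =
      sSup {c : ℕ | ∃ f : V → E, G.IsChoice f ∧
        c = {e : E | {v : V | f v = e}.ncard = 2}.ncard} := by
  obtain ⟨f₀, hf₀⟩ : ∃ f : V → E, G.IsChoice f := Classical.skolem.1 hiso
  constructor
  · apply le_antisymm
    · refine le_csInf ⟨_, f₀, hf₀, rfl⟩ ?_
      rintro c ⟨f, hf, rfl⟩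
      exact Nat.sInf_le ⟨Set.range f, hf.isEdgeCover_range, hf.ncard_range⟩
    · refine le_csInf ⟨_, _, hf₀.isEdgeCover_range, rfl⟩ ?_
      rintro c ⟨C, hC, rfl⟩
      obtain ⟨f, hf, hfC⟩ := hC.exists_isChoice
      exact le_trans (Nat.sInf_le ⟨f, hf, hf.ncard_range⟩) (Set.ncard_le_ncard hfC)
  · apply le_antisymm
    · refine csSup_le ⟨_, _, hf₀.isMatching_ncard_fiber_eq_two, rfl⟩ ?_
      rintro c ⟨M, hM, rfl⟩
      obtain ⟨f, hf, hMf⟩ := hM.exists_isChoice hiso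
      refine (Set.ncard_le_ncard hMf).trans (le_csSup ⟨Nat.card E, ?_⟩ ⟨f, hf, rfl⟩)
      rintro c ⟨g, -, rfl⟩
      exact Set.ncard_le_card _
    · refine csSup_le ⟨_, f₀, hf₀, rfl⟩ ?_
      rintro c ⟨f, hf, rfl⟩
      refine le_csSup ⟨Nat.card E, ?_⟩ ⟨_, hf.isMatching_ncard_fiber_eq_two, rfl⟩
      rintro c ⟨M, -, rfl⟩
      exact Set.ncard_le_card _

end Multigraph
end
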